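/- Let α > 0, β > 0, p ≥ 1. Every extremal point μ of B_{α,β} := {μ ∈ M_p(Z) : G_{α,β}(μ) ≤ 1} is necessarily of the form μ = a δ_x − a δ_y + μ(Z) δ_e, where x, y ∈ Z and a > 0 is a normalizing constant satisfying 1 = α(a d(x,y) + |μ(Z)|) + β ∫_Z (1 + d(z,e)^p) d|a δ_x − a δ_y + μ(Z) δ_e|(z). -/

import Mathlib

open MeasureTheory Filter Topology
open scoped ENNReal NNReal

noncomputable section
attribute [local instance] Classical.propDecidable

variable {Z : Type*} [MetricSpace Z] [MeasurableSpace Z] [BorelSpace Z]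

/-- Integral `∫ f dμ` of a function against a finite signed measure, via Jordan decomposition. -/
def sInteg (μ : SignedMeasure Z) (f : Z → ℝ) : ℝ :=
  (∫ z, f z ∂μ.toJordanDecomposition.posPart) - ∫ z, f z ∂μ.toJordanDecomposition.negPart

/-- Total variation norm `‖μ‖_TV`. -/
def tvNorm (μ : SignedMeasure Z) : ℝ := (μ.totalVariation Set.univ).toReal

/-- The unbalanced Kantorovich–Rubinstein norm
`‖μ‖_KRu = |μ(Z)| + sup { ∫ f dμ : f(e) = 0, Lip(f) ≤ 1 }`. -/
def kruNorm (e : Z) (μ : SignedMeasure Z) : ℝ :=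
  |μ Set.univ| +
    sSup {r : ℝ | ∃ f : Z → ℝ, f e = 0 ∧ LipschitzWith 1 f ∧ r = sInteg μ f}

/-- The balanced Kantorovich–Rubinstein norm `‖μ‖_KR = sup { ∫ f dμ : f(e) = 0, Lip(f) ≤ 1 }`. -/
def krNorm (e : Z) (μ : SignedMeasure Z) : ℝ :=
  sSup {r : ℝ | ∃ f : Z → ℝ, f e = 0 ∧ LipschitzWith 1 f ∧ r = sInteg μ f}

/-- `μ ∈ M_1(Z)`: finite first moment, `∫ d(z,e) d|μ| < ∞`. -/
def MemM1 (e : Z) (μ : SignedMeasure Z) : Prop :=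
  (∫⁻ z, ENNReal.ofReal (dist z e) ∂μ.totalVariation) < ⊤

/-- `μ ∈ M_p(Z)`: finite `p`-th moment, `∫ d(z,e)^p d|μ| < ∞`. -/
def MemMp (e : Z) (p : ℝ) (μ : SignedMeasure Z) : Prop :=
  (∫⁻ z, ENNReal.ofReal (dist z e ^ p) ∂μ.totalVariation) < ⊤

/-- `∫ (1 + d(z,e)^p) d|μ|` as an extended nonnegative real number. -/
def momLint (e : Z) (p : ℝ) (μ : SignedMeasure Z) : ℝ≥0∞ :=
  ∫⁻ z, ENNReal.ofReal (1 + dist z e ^ p) ∂μ.totalVariation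

/-- Dirac measure at a point, as a signed measure. -/
def diracSM (x : Z) : SignedMeasure Z := (Measure.dirac x).toSignedMeasure

/-- The regularizer `G_{α,β}(μ) = α‖μ‖_KRu + β ∫ (1 + d(z,e)^p) d|μ|` if `μ ∈ M_p(Z)`,
and `+∞` otherwise, as an extended real number. -/
def Gab (e : Z) (p α β : ℝ) (μ : SignedMeasure Z) : EReal :=
  if MemMp e p μ then ((α * kruNorm e μ + β * (momLint e p μ).toReal : ℝ) : EReal) else ⊤

/-- A geodesic metric space: any two points are joined by points realizing all
intermediate distance proportions. -/
def IsGeodesic (Z : Type*) [MetricSpace Z] : Prop :=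
  ∀ x y : Z, ∀ t : ℝ, 0 ≤ t → t ≤ 1 →
    ∃ z : Z, dist x z = t * dist x y ∧ dist z y = (1 - t) * dist x y

lemma sandwich {E : Type*} [AddCommGroup E] [Module ℝ E] (q : E → ℝ)
    (q_hom : ∀ c : ℝ, 0 < c → ∀ x, q (c • x) = c * q x)
    (q_add : ∀ x y, q (x + y) ≤ q x + q y) (D : Set (E × ℝ)) (hne : D.Nonempty)
    (hadd : ∀ x ∈ D, ∀ y ∈ D, x + y ∈ D) (hsmul : ∀ c : ℝ, 0 < c → ∀ x ∈ D, c • x ∈ D)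
    (hD : ∀ x ∈ D, 0 ≤ q x.1 + x.2) :
    ∃ S : E →ₗ[ℝ] ℝ, (∀ u, S u ≤ q u) ∧ ∀ x ∈ D, S (-x.1) ≤ x.2 := by
  have q0 : q 0 = 0 := by
    have := q_hom 2 (by norm_num) 0
    rw [smul_zero] at this; linarith
  let N : E → ℝ := fun u => sInf ((fun x : E × ℝ => q (u + x.1) + x.2) '' D)
  have bdd : ∀ u, BddBelow ((fun x : E × ℝ => q (u + x.1) + x.2) '' D) := by
    intro u
    refine ⟨-q (-u), ?_⟩
    rintro _ ⟨x, hx, rfl⟩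
    have h1 := q_add (-u) (u + x.1)
    rw [neg_add_cancel_left] at h1
    have h2 := hD x hx
    simp only
    linarith
  have nle : ∀ u, ∀ x ∈ D, N u ≤ q (u + x.1) + x.2 := fun u x hx =>
    csInf_le (bdd u) ⟨x, hx, rfl⟩
  have leN : ∀ u r, (∀ x ∈ D, r ≤ q (u + x.1) + x.2) → r ≤ N u := by
    intro u r h
    refine le_csInf (hne.image _) ?_
    rintro _ ⟨x, hx, rfl⟩
    exact h x hx
  have hom_le : ∀ c : ℝ, 0 < c → ∀ u, c * N u ≤ N (c • u) := by
    intro c hc u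
    refine leN _ _ fun x hx => ?_
    have h := nle u (c⁻¹ • x) (hsmul _ (inv_pos.2 hc) x hx)
    have h2 : q (c • u + x.1) = c * q (u + (c⁻¹ • x).1) := by
      rw [← q_hom c hc, smul_add, Prod.smul_fst, smul_inv_smul₀ hc.ne']
    rw [h2]
    have : c * (c⁻¹ • x).2 = x.2 := by
      rw [Prod.smul_snd, smul_eq_mul, mul_inv_cancel_left₀ hc.ne']
    nlinarith [mul_le_mul_of_nonneg_left h hc.le]
  obtain ⟨S, -, hS⟩ := exists_extension_of_le_sublinear (⟨⊥, 0⟩ : E →ₗ.[ℝ] ℝ) N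
    (by
      intro c hc u
      refine le_antisymm ?_ (hom_le c hc u)
      have := hom_le c⁻¹ (inv_pos.2 hc) (c • u)
      rw [inv_smul_smul₀ hc.ne', inv_mul_le_iff₀ hc] at this
      exact this)
    (by
      intro u v
      rw [← sub_le_iff_le_add]
      refine leN _ _ fun x hx => ?_
      rw [sub_le_comm]
      refine leN _ _ fun y hy => ?_
      have h1 := nle (u + v) (x + y) (hadd x hx y hy)
      have h2 := q_add (u + x.1) (v + y.1)
      have h3 : u + v + (x + y).1 = u + x.1 + (v + y.1) := by
        rw [Prod.fst_add]; abel
      rw [h3, Prod.snd_add] at h1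
      linarith)
    (by
      rintro ⟨x, hx⟩
      have : x = 0 := by simpa using hx
      subst this
      refine leN _ _ fun x hx => ?_
      simpa using hD x hx)
  refine ⟨S, fun u => ?_, fun x hx => ?_⟩
  · obtain ⟨x, hx⟩ := hne
    have h := hD x hx
    have key : ∀ ε : ℝ, 0 < ε → S u ≤ q u + ε * (q x.1 + x.2) := by
      intro ε hε
      have h1 := (hS u).trans (nle u _ (hsmul ε hε x hx))
      have h2 := q_add u (ε • x).1
      rw [Prod.smul_fst, q_hom ε hε] at h2
      simp only [Prod.smul_fst, Prod.smul_snd, smul_eq_mul] at h1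
      linarith
    rcases h.eq_or_lt with h0 | h0
    · have := key 1 one_pos; linarith
    · refine le_of_forall_pos_le_add fun ε hε => ?_
      have := key (ε / (q x.1 + x.2)) (div_pos hε h0)
      rwa [div_mul_cancel₀ _ h0.ne'] at this
  · have := (hS _).trans (nle (-x.1) x hx)
    simpa [q0] using this

lemma riesz01 {Z : Type*} [MeasurableSpace Z] (m : Measure Z) [IsFiniteMeasure m]
    (S : Lp ℝ 2 m →ₗ[ℝ] ℝ) (hS : ∀ u : Lp ℝ 2 m, S u ≤ ∫ z, max (u z) 0 ∂m) :
    ∃ g : Z → ℝ, Measurable g ∧ (∀ z, 0 ≤ g z) ∧ (∀ z, g z ≤ 1) ∧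
      ∀ u : Lp ℝ 2 m, S u = ∫ z, g z * u z ∂m := by
  have i1 : ∀ u : Lp ℝ 2 m, Integrable u m := fun u =>
    (Lp.memLp u).integrable (by norm_num)
  -- continuity
  have hb : ∀ u : Lp ℝ 2 m, S u ≤ (m.real Set.univ) ^ (1/2:ℝ) * ‖u‖ := by
    intro u
    refine (hS u).trans ?_
    have h1 : ∫ z, max (u z) 0 ∂m ≤ ∫ z, ‖u z‖ ∂m := by
      refine integral_mono (i1 u).pos_part (i1 u).norm fun z => ?_
      exact max_le (le_abs_self _) (abs_nonneg _)
    refine h1.trans ?_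
    have h2 := eLpNorm_le_eLpNorm_mul_rpow_measure_univ (p := 1) (q := 2) (μ := m) (f := u)
      (by norm_num) (Lp.memLp u).1
    rw [eLpNorm_one_eq_lintegral_enorm] at h2
    rw [integral_norm_eq_lintegral_enorm (Lp.memLp u).1]
    have h3 := ENNReal.toReal_mono (ENNReal.mul_ne_top (Lp.memLp u).2.ne
      (ENNReal.rpow_ne_top_of_nonneg (by norm_num) (measure_ne_top m _))) h2
    refine h3.trans (le_of_eq ?_)
    rw [ENNReal.toReal_mul, Lp.norm_def, mul_comm, ← ENNReal.toReal_rpow]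
    norm_num [Measure.real]
  let T : StrongDual ℝ (Lp ℝ 2 m) := S.mkContinuous ((m.real Set.univ) ^ (1/2:ℝ)) (by
    intro u
    rw [Real.norm_eq_abs, abs_le]
    constructor
    · have := hb (-u)
      rw [map_neg, norm_neg] at this
      linarith
    · exact hb u)
  let k : Lp ℝ 2 m := (InnerProductSpace.toDual ℝ (Lp ℝ 2 m)).symm T
  have hk : ∀ u : Lp ℝ 2 m, S u = ∫ z, k z * u z ∂m := by
    intro u
    have : inner ℝ k u = T u := InnerProductSpace.toDual_symm_apply
    rw [L2.inner_def] at this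
    rw [show S u = T u from rfl, ← this]
    refine integral_congr_ae (Eventually.of_forall fun z => ?_)
    simp [mul_comm]
  have hset : ∀ s, MeasurableSet s → ∀ c : ℝ, c * ∫ z in s, k z ∂m ≤ max c 0 * m.real s := by
    intro s hs c
    have h := hS (indicatorConstLp 2 hs (measure_ne_top m s) c)
    rw [hk] at h
    have e1 : ∫ z, k z * (indicatorConstLp 2 hs (measure_ne_top m s) c : Lp ℝ 2 m) z ∂m
        = c * ∫ z in s, k z ∂m := by
      rw [← integral_const_mul, ← integral_indicator hs]
      refine integral_congr_ae ?_
      filter_upwards [indicatorConstLp_coeFn (p := 2) (hs := hs) (hμs := measure_ne_top m s) (c := c)] with z hz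
      rw [hz]
      by_cases h : z ∈ s <;> simp [h, mul_comm]
    have e2 : ∫ z, max ((indicatorConstLp 2 hs (measure_ne_top m s) c : Lp ℝ 2 m) z) 0 ∂m
        = max c 0 * m.real s := by
      have : ∫ z in s, max c 0 ∂m = max c 0 * m.real s := by
        simp [mul_comm]
      rw [← this, ← integral_indicator hs]
      refine integral_congr_ae ?_
      filter_upwards [indicatorConstLp_coeFn (p := 2) (hs := hs) (hμs := measure_ne_top m s) (c := c)] with z hz
      rw [hz]
      by_cases h : z ∈ s <;> simp [h]
    rw [e1, e2] at h
    exact h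
  have k0 : 0 ≤ᵐ[m] k := by
    refine ae_nonneg_of_forall_setIntegral_nonneg (i1 k) fun s hs _ => ?_
    have := hset s hs (-1)
    norm_num at this
    linarith
  have k1 : k ≤ᵐ[m] fun _ => (1:ℝ) := by
    refine ae_le_of_forall_setIntegral_le (i1 k) (integrable_const _) fun s hs _ => ?_
    have := hset s hs 1
    norm_num at this
    simpa using this
  obtain ⟨k', hk'm, hk'⟩ := (Lp.memLp k).1.aemeasurable
  refine ⟨fun z => max 0 (min 1 (k' z)), by fun_prop, fun z => le_max_left _ _,
    fun z => max_le zero_le_one (min_le_left _ _), fun u => ?_⟩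
  rw [hk]
  refine integral_congr_ae ?_
  filter_upwards [k0, k1, hk'] with z h0 h1 h2
  simp only [Pi.zero_apply] at h0
  rw [← h2, min_eq_right h1, max_eq_right h0]

lemma lip_integrable {Z : Type*} [MetricSpace Z] [MeasurableSpace Z] [BorelSpace Z]
    (e : Z) (P : Measure Z) [IsFiniteMeasure P] (hP : Integrable (fun z => dist z e) P)
    {K : ℝ≥0} {f : Z → ℝ} (hf : LipschitzWith K f) : Integrable f P := by
  refine Integrable.mono' ((integrable_const |f e|).add (hP.const_mul K))
    hf.continuous.measurable.aestronglyMeasurable (Eventually.of_forall fun z => ?_)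
  have h := hf.dist_le_mul z e
  rw [Real.dist_eq] at h
  have h2 : |f z| ≤ |f z - f e| + |f e| := by
    simpa using abs_add_le (f z - f e) (f e)
  simp only [Pi.add_apply, Real.norm_eq_abs]
  linarith

lemma split_lemma {Z : Type*} [MetricSpace Z] [MeasurableSpace Z] [BorelSpace Z]
    (e : Z) (P Q : Measure Z) [IsFiniteMeasure P] [IsFiniteMeasure Q]
    (hP : Integrable (fun z => dist z e) P) (hQ : Integrable (fun z => dist z e) Q)
    (N : ℝ)
    (hN : ∀ f : Z → ℝ, LipschitzWith 1 f → ∫ z, f z ∂P - ∫ z, f z ∂Q ≤ N)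
    (B : Set Z) (hB : MeasurableSet B) :
    ∃ g : Z → ℝ, Measurable g ∧ (∀ z, 0 ≤ g z) ∧ (∀ z, g z ≤ 1) ∧
      ∀ f₁ f₂ : Z → ℝ, LipschitzWith 1 f₁ → LipschitzWith 1 f₂ →
        ∫ z in B, f₁ z ∂P + ∫ z in Bᶜ, f₂ z ∂P
          - ∫ z, (g z * f₁ z + (1 - g z) * f₂ z) ∂Q ≤ N := by
  have hNK : ∀ K : ℝ≥0, 0 < K → ∀ f : Z → ℝ, LipschitzWith K f →
      ∫ z, f z ∂P - ∫ z, f z ∂Q ≤ K * N := by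
    intro K hK f hf
    have hK' : (0:ℝ) < K := by exact_mod_cast hK
    have h1 : LipschitzWith 1 (fun z => (K:ℝ)⁻¹ * f z) := by
      refine LipschitzWith.of_dist_le_mul fun x y => ?_
      have := hf.dist_le_mul x y
      rw [Real.dist_eq] at this ⊢
      rw [← mul_sub, abs_mul, abs_of_pos (inv_pos.2 hK'), inv_mul_le_iff₀ hK']
      simpa using this
    have h2 := hN _ h1
    rw [integral_const_mul, integral_const_mul, ← mul_sub, inv_mul_le_iff₀ hK'] at h2
    exact h2
  have wpos : ∀ z, 0 < 1 + dist z e := fun z => by positivity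
  let w : Z → ℝ≥0 := fun z => 1 + nndist z e
  have hw : ∀ z, (w z : ℝ) = 1 + dist z e := fun z => by simp [w]
  have hwm : Measurable w := by
    have : Continuous w := by fun_prop
    exact this.measurable
  let m : Measure Z := Q.withDensity (fun z => (w z : ℝ≥0∞))
  have hwQ : Integrable (fun z => (w z : ℝ)) Q := by
    simp only [hw]; exact (integrable_const 1).add hQ
  have : IsFiniteMeasure m := by
    refine ⟨?_⟩
    rw [withDensity_apply _ MeasurableSet.univ, Measure.restrict_univ]
    have := hwQ.2
    simp only [HasFiniteIntegral] at this
    convert this using 2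
    ext z
    simp
  have hmQ : ∀ h : Z → ℝ, ∫ z, h z ∂m = ∫ z, (w z : ℝ) * h z ∂Q := fun h => by
    rw [integral_withDensity_eq_integral_smul hwm]; rfl
  have lipI : ∀ {K : ℝ≥0} {f : Z → ℝ}, LipschitzWith K f → Integrable f Q := fun hf =>
    lip_integrable e Q hQ hf
  have lipIP : ∀ {K : ℝ≥0} {f : Z → ℝ}, LipschitzWith K f → Integrable f P := fun hf =>
    lip_integrable e P hP hf
  -- membership of Lipschitz quotients
  have hmem : ∀ {K : ℝ≥0} {f : Z → ℝ}, LipschitzWith K f →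
      MemLp (fun z => f z / (w z : ℝ)) 2 m := by
    intro K f hf
    refine MemLp.of_bound (C := |f e| + K) ?_ (Eventually.of_forall fun z => ?_)
    · exact (hf.continuous.measurable.div
        (measurable_coe_nnreal_real.comp hwm)).aestronglyMeasurable
    · have h := hf.dist_le_mul z e
      rw [Real.dist_eq] at h
      have h2 : |f z| ≤ |f z - f e| + |f e| := by
        simpa using abs_add_le (f z - f e) (f e)
      rw [Real.norm_eq_abs, hw, abs_div, abs_of_pos (wpos z), div_le_iff₀ (wpos z)]
      nlinarith [abs_nonneg (f e), K.2, dist_nonneg (x := z) (y := e),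
        mul_nonneg (abs_nonneg (f e)) (dist_nonneg (x := z) (y := e))]
  let q : Lp ℝ 2 m → ℝ := fun u => ∫ z, max (u z) 0 ∂m
  have i1 : ∀ u : Lp ℝ 2 m, Integrable u m := fun u =>
    (Lp.memLp u).integrable (by norm_num)
  let D : Set (Lp ℝ 2 m × ℝ) := {x | ∃ (K : ℝ≥0) (f₁ f₂ : Z → ℝ), 0 < K ∧
    LipschitzWith K f₁ ∧ LipschitzWith K f₂ ∧ (∀ᵐ z ∂m, x.1 z = (f₁ z - f₂ z) / (w z : ℝ)) ∧
    x.2 = K * N + ∫ z, f₂ z ∂Q - ∫ z in B, f₁ z ∂P - ∫ z in Bᶜ, f₂ z ∂P}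
  have hDof : ∀ f₁ f₂ : Z → ℝ, LipschitzWith 1 f₁ → LipschitzWith 1 f₂ →
      ∃ x ∈ D, (∀ᵐ z ∂m, x.1 z = (f₁ z - f₂ z) / (w z : ℝ)) ∧
        x.2 = N + ∫ z, f₂ z ∂Q - ∫ z in B, f₁ z ∂P - ∫ z in Bᶜ, f₂ z ∂P := by
    intro f₁ f₂ h₁ h₂
    have hm : MemLp (fun z => (f₁ z - f₂ z) / (w z : ℝ)) 2 m := by
      have := (hmem h₁).sub (hmem h₂)
      refine this.ae_eq (Eventually.of_forall fun z => ?_)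
      simp [sub_div]
    refine ⟨⟨hm.toLp, _⟩, ⟨1, f₁, f₂, one_pos, h₁, h₂, hm.coeFn_toLp, rfl⟩, hm.coeFn_toLp, ?_⟩
    simp
  obtain ⟨S, hSq, hSD⟩ := sandwich q
    (by
      intro c hc u
      simp only [q]
      rw [← integral_const_mul]
      refine integral_congr_ae ?_
      filter_upwards [Lp.coeFn_smul c u] with z hz
      rw [hz, Pi.smul_apply, smul_eq_mul, mul_max_of_nonneg _ _ hc.le, mul_zero])
    (by
      intro u v
      simp only [q]
      rw [← integral_add (i1 u).pos_part (i1 v).pos_part]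
      refine integral_mono_ae (i1 (u + v)).pos_part ((i1 u).pos_part.add (i1 v).pos_part) ?_
      filter_upwards [Lp.coeFn_add u v] with z hz
      rw [hz, Pi.add_apply]
      refine max_le (add_le_add (le_max_left _ _) (le_max_left _ _)) ?_
      exact add_nonneg (le_max_right _ _) (le_max_right _ _))
    D
    (by
      obtain ⟨x, hx, -⟩ := hDof (fun _ => 0) (fun _ => 0) (LipschitzWith.const' 0)
        (LipschitzWith.const' 0)
      exact ⟨x, hx⟩)
    (by
      rintro x ⟨K, f₁, f₂, hK, h₁, h₂, hx, hx'⟩ y ⟨L, g₁, g₂, hL, k₁, k₂, hy, hy'⟩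
      refine ⟨K + L, fun z => f₁ z + g₁ z, fun z => f₂ z + g₂ z, add_pos hK hL, h₁.add k₁,
        h₂.add k₂, ?_, ?_⟩
      · filter_upwards [hx, hy, Lp.coeFn_add x.1 y.1] with z a b c
        rw [Prod.fst_add, c, Pi.add_apply, a, b]
        ring
      · rw [integral_add (lipI h₂) (lipI k₂),
          integral_add (lipIP h₁).integrableOn (lipIP k₁).integrableOn,
          integral_add (lipIP h₂).integrableOn (lipIP k₂).integrableOn, Prod.snd_add, hx', hy']
        push_cast
        ring)
    (by
      rintro c hc x ⟨K, f₁, f₂, hK, h₁, h₂, hx, hx'⟩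
      lift c to ℝ≥0 using hc.le
      have hl : ∀ f : Z → ℝ, LipschitzWith K f →
          LipschitzWith (c * K) (fun z => c * f z) := by
        intro f hf
        refine LipschitzWith.of_dist_le_mul fun x y => ?_
        have := hf.dist_le_mul x y
        rw [Real.dist_eq] at this ⊢
        rw [← mul_sub, abs_mul, abs_of_pos hc, NNReal.coe_mul, mul_assoc]
        exact mul_le_mul_of_nonneg_left this hc.le
      refine ⟨c * K, fun z => c * f₁ z, fun z => c * f₂ z,
        mul_pos (by exact_mod_cast hc) hK, hl _ h₁, hl _ h₂, ?_, ?_⟩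
      · filter_upwards [hx, Lp.coeFn_smul (c : ℝ) x.1] with z a b
        rw [Prod.smul_fst, b, Pi.smul_apply, a, smul_eq_mul]
        ring
      · rw [integral_const_mul, integral_const_mul, integral_const_mul, Prod.smul_snd, hx',
          smul_eq_mul, NNReal.coe_mul]
        ring)
    (by
      rintro x ⟨K, f₁, f₂, hK, h₁, h₂, hx, hx'⟩
      have e1 : q x.1 = ∫ z, max (f₁ z) (f₂ z) - f₂ z ∂Q := by
        simp only [q]
        have : ∫ z, max (x.1 z) 0 ∂m = ∫ z, max ((f₁ z - f₂ z) / (w z : ℝ)) 0 ∂m := by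
          refine integral_congr_ae ?_
          filter_upwards [hx] with z hz
          rw [hz]
        rw [this, hmQ]
        refine integral_congr_ae (Eventually.of_forall fun z => ?_)
        have hz : (0:ℝ) < w z := by rw [hw]; exact wpos z
        simp only
        rw [mul_max_of_nonneg _ _ hz.le, mul_zero, mul_div_cancel₀ _ hz.ne', ← max_sub_sub_right,
          sub_self]
      have hmax : LipschitzWith K (fun z => max (f₁ z) (f₂ z)) := by
        have := h₁.max h₂
        rwa [max_self] at this
      rw [e1, integral_sub (lipI hmax) (lipI h₂), hx']
      have h3 := hNK K hK _ hmax
      rw [← integral_add_compl hB (lipIP hmax)] at h3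
      have h4 : ∫ z in B, f₁ z ∂P ≤ ∫ z in B, max (f₁ z) (f₂ z) ∂P :=
        integral_mono (lipIP h₁).integrableOn (lipIP hmax).integrableOn fun z => le_max_left _ _
      have h5 : ∫ z in Bᶜ, f₂ z ∂P ≤ ∫ z in Bᶜ, max (f₁ z) (f₂ z) ∂P :=
        integral_mono (lipIP h₂).integrableOn (lipIP hmax).integrableOn fun z => le_max_right _ _
      linarith)
  obtain ⟨g, hgm, hg0, hg1, hg⟩ := riesz01 m S hSq
  refine ⟨g, hgm, hg0, hg1, fun f₁ f₂ h₁ h₂ => ?_⟩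
  obtain ⟨x, hxD, hx, hx2⟩ := hDof f₁ f₂ h₁ h₂
  have h := hSD x hxD
  rw [hg, hx2] at h
  have e1 : ∫ z, g z * (-x.1 : Lp ℝ 2 m) z ∂m = ∫ z, g z * (f₂ z - f₁ z) ∂Q := by
    have : ∫ z, g z * (-x.1 : Lp ℝ 2 m) z ∂m
        = ∫ z, g z * ((f₂ z - f₁ z) / (w z : ℝ)) ∂m := by
      refine integral_congr_ae ?_
      filter_upwards [hx, Lp.coeFn_neg x.1] with z a b
      rw [b, Pi.neg_apply, a]
      ring
    rw [this, hmQ]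
    refine integral_congr_ae (Eventually.of_forall fun z => ?_)
    have hz : (0:ℝ) < w z := by rw [hw]; exact wpos z
    simp only
    field_simp
  rw [e1] at h
  have hgi : ∀ {f : Z → ℝ}, Integrable f Q → Integrable (fun z => g z * f z) Q := by
    intro f hf
    refine hf.bdd_mul (c := 1) hgm.aestronglyMeasurable (Eventually.of_forall fun z => ?_)
    rw [Real.norm_eq_abs, abs_of_nonneg (hg0 z)]
    exact hg1 z
  have e2 : ∫ z, (g z * f₁ z + (1 - g z) * f₂ z) ∂Q
      = ∫ z, f₂ z ∂Q - ∫ z, g z * (f₂ z - f₁ z) ∂Q := by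
    rw [← integral_sub (lipI h₂) (hgi (f := fun z => f₂ z - f₁ z) ((lipI h₂).sub (lipI h₁)))]
    refine integral_congr_ae (Eventually.of_forall fun z => ?_)
    simp only
    ring
  rw [e2]
  linarith
set_option linter.unusedSectionVars false

/-! ### Signed measures -/

lemma sInteg_sub (A B : Measure Z) [IsFiniteMeasure A] [IsFiniteMeasure B] (μ : SignedMeasure Z)
    (hμ : μ = A.toSignedMeasure - B.toSignedMeasure) :
    μ.toJordanDecomposition.posPart ≤ A ∧ μ.toJordanDecomposition.negPart ≤ B ∧
      ∀ f : Z → ℝ, Integrable f A → Integrable f B →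
        sInteg μ f = ∫ z, f z ∂A - ∫ z, f z ∂B := by
  have hp : μ.toJordanDecomposition.posPart ≤ A := by
    rw [hμ, Measure.toJordanDecomposition_toSignedMeasure_sub]
    exact Measure.sub_le
  have hn : μ.toJordanDecomposition.negPart ≤ B := by
    rw [hμ, Measure.toJordanDecomposition_toSignedMeasure_sub]
    exact Measure.sub_le
  refine ⟨hp, hn, fun f hA hB => ?_⟩
  have hm : μ.toJordanDecomposition.posPart + B = A + μ.toJordanDecomposition.negPart := by
    ext s hs
    rw [← ENNReal.toReal_eq_toReal_iff' (measure_ne_top _ _) (measure_ne_top _ _)]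
    change (μ.toJordanDecomposition.posPart + B).real s
      = (A + μ.toJordanDecomposition.negPart).real s
    rw [measureReal_add_apply, measureReal_add_apply]
    have h1 := SignedMeasure.apply_eq_posPart_real_sub_negPart_real μ hs
    have h2 : μ s = A.real s - B.real s := by
      conv_lhs => rw [hμ]
      exact Measure.toSignedMeasure_sub_apply hs
    linarith
  have h3 : ∫ z, f z ∂(μ.toJordanDecomposition.posPart + B)
      = ∫ z, f z ∂(A + μ.toJordanDecomposition.negPart) := by rw [hm]
  rw [integral_add_measure (hA.mono_measure hp) hB,
    integral_add_measure hA (hB.mono_measure hn)] at h3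
  unfold sInteg
  linarith

lemma eq_pos_sub_neg (μ : SignedMeasure Z) :
    μ = μ.toJordanDecomposition.posPart.toSignedMeasure
      - μ.toJordanDecomposition.negPart.toSignedMeasure :=
  (SignedMeasure.toSignedMeasure_toJordanDecomposition μ).symm

/-- Jordan decomposition of the measure with density `ρ` with respect to `μ`. -/
def dsmJ (ρ : Z → ℝ≥0) (hρ1 : ∀ z, ρ z ≤ 1) (μ : SignedMeasure Z) :
    JordanDecomposition Z :=
  have hf : ∀ (M : Measure Z) [IsFiniteMeasure M],
      IsFiniteMeasure (M.withDensity fun z => (ρ z : ℝ≥0∞)) := fun M _ => by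
    refine isFiniteMeasure_withDensity (ne_of_lt ?_)
    calc ∫⁻ z, (ρ z : ℝ≥0∞) ∂M ≤ ∫⁻ _, 1 ∂M :=
          lintegral_mono fun z => ENNReal.coe_le_coe.2 (hρ1 z)
      _ < ⊤ := by simp
  { posPart := μ.toJordanDecomposition.posPart.withDensity fun z => (ρ z : ℝ≥0∞)
    negPart := μ.toJordanDecomposition.negPart.withDensity fun z => (ρ z : ℝ≥0∞)
    posPart_finite := hf _
    negPart_finite := hf _
    mutuallySingular := μ.toJordanDecomposition.mutuallySingular.mono_ac
      (withDensity_absolutelyContinuous _ _) (withDensity_absolutelyContinuous _ _) }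

/-- The signed measure with density `ρ` with respect to `μ`. -/
def dsm (ρ : Z → ℝ≥0) (hρ1 : ∀ z, ρ z ≤ 1) (μ : SignedMeasure Z) : SignedMeasure Z :=
  (dsmJ ρ hρ1 μ).toSignedMeasure

lemma dsm_J (ρ : Z → ℝ≥0) (hρ1 : ∀ z, ρ z ≤ 1) (μ : SignedMeasure Z) :
    (dsm ρ hρ1 μ).toJordanDecomposition = dsmJ ρ hρ1 μ :=
  JordanDecomposition.toJordanDecomposition_toSignedMeasure _

lemma dsm_tv (ρ : Z → ℝ≥0) (hρ1 : ∀ z, ρ z ≤ 1) (μ : SignedMeasure Z) :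
    (dsm ρ hρ1 μ).totalVariation = μ.totalVariation.withDensity fun z => (ρ z : ℝ≥0∞) := by
  rw [SignedMeasure.totalVariation, dsm_J, SignedMeasure.totalVariation, withDensity_add_measure]
  rfl

lemma dsm_sInteg (ρ : Z → ℝ≥0) (hρm : Measurable ρ) (hρ1 : ∀ z, ρ z ≤ 1) (μ : SignedMeasure Z)
    (f : Z → ℝ) : sInteg (dsm ρ hρ1 μ) f = sInteg μ (fun z => ρ z * f z) := by
  unfold sInteg
  rw [dsm_J]
  change ∫ z, f z ∂(μ.toJordanDecomposition.posPart.withDensity fun z => (ρ z : ℝ≥0∞))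
    - ∫ z, f z ∂(μ.toJordanDecomposition.negPart.withDensity fun z => (ρ z : ℝ≥0∞)) = _
  rw [integral_withDensity_eq_integral_smul hρm, integral_withDensity_eq_integral_smul hρm]
  rfl

lemma sInteg_indicator (μ : SignedMeasure Z) (A : Set Z) (hA : MeasurableSet A) :
    μ A = sInteg μ (A.indicator fun _ => 1) := by
  unfold sInteg
  rw [integral_indicator hA, integral_indicator hA,
    SignedMeasure.apply_eq_posPart_real_sub_negPart_real μ hA]
  simp

lemma dsm_apply (ρ : Z → ℝ≥0) (hρm : Measurable ρ) (hρ1 : ∀ z, ρ z ≤ 1) (μ : SignedMeasure Z)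
    (A : Set Z) (hA : MeasurableSet A) :
    dsm ρ hρ1 μ A = sInteg μ (A.indicator fun z => (ρ z : ℝ)) := by
  rw [sInteg_indicator _ A hA, dsm_sInteg ρ hρm]
  congr 1
  ext z
  by_cases h : z ∈ A <;> simp [h]

lemma bdd_int (ρ : Z → ℝ≥0) (hρm : Measurable ρ) (hρ1 : ∀ z, ρ z ≤ 1) (M : Measure Z)
    {f : Z → ℝ} (hf : Integrable f M) : Integrable (fun z => (ρ z : ℝ) * f z) M := by
  refine hf.bdd_mul (c := 1) (measurable_coe_nnreal_real.comp hρm).aestronglyMeasurable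
    (Eventually.of_forall fun z => ?_)
  simpa using hρ1 z

lemma bdd_int' (ρ : Z → ℝ≥0) (hρm : Measurable ρ) (hρ1 : ∀ z, ρ z ≤ 1) (M : Measure Z)
    [IsFiniteMeasure M] : Integrable (fun z => (ρ z : ℝ)) M := by
  simpa using bdd_int ρ hρm hρ1 M (integrable_const (1:ℝ))

lemma dsm_add (ρ ρ' : Z → ℝ≥0) (hρm : Measurable ρ) (hρ1 : ∀ z, ρ z ≤ 1)
    (hρm' : Measurable ρ') (hρ1' : ∀ z, ρ' z ≤ 1)
    (hs : ∀ z, ρ z + ρ' z = 1) (μ : SignedMeasure Z) :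
    dsm ρ hρ1 μ + dsm ρ' hρ1' μ = μ := by
  ext A hA
  have h : ∀ z, (ρ z : ℝ) + ρ' z = 1 := fun z => by exact_mod_cast hs z
  rw [_root_.add_apply, dsm_apply ρ hρm _ _ A hA, dsm_apply ρ' hρm' _ _ A hA,
    sInteg_indicator μ A hA]
  unfold sInteg
  simp only [integral_indicator hA]
  have key : ∀ M : Measure Z, IsFiniteMeasure M → ∫ z in A, (1:ℝ) ∂M
      = ∫ z in A, (ρ z : ℝ) ∂M + ∫ z in A, (ρ' z : ℝ) ∂M := by
    intro M _
    rw [← integral_add (bdd_int' ρ hρm hρ1 _) (bdd_int' ρ' hρm' hρ1' _)]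
    simp only [h]
  rw [key _ inferInstance, key _ inferInstance]
  ring

lemma dist_meas (e : Z) (p : ℝ) (hp : 1 ≤ p) :
    Measurable fun z : Z => ENNReal.ofReal (dist z e ^ p) := by
  have : Continuous fun z : Z => dist z e ^ p :=
    (continuous_id.dist continuous_const).rpow_const fun z => Or.inr (by linarith)
  exact this.measurable.ennreal_ofReal

lemma mom_meas (e : Z) (p : ℝ) (hp : 1 ≤ p) :
    Measurable fun z : Z => ENNReal.ofReal (1 + dist z e ^ p) := by
  have : Continuous fun z : Z => 1 + dist z e ^ p := continuous_const.add
    ((continuous_id.dist continuous_const).rpow_const fun z => Or.inr (by linarith))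
  exact this.measurable.ennreal_ofReal

lemma tv_finite (μ : SignedMeasure Z) : IsFiniteMeasure μ.totalVariation := by
  unfold SignedMeasure.totalVariation; infer_instance

lemma momLint_ne_top (e : Z) (p : ℝ) (μ : SignedMeasure Z) (h : MemMp e p μ) :
    momLint e p μ ≠ ⊤ := by
  have := tv_finite μ
  unfold momLint
  have h1 : ∀ z : Z, ENNReal.ofReal (1 + dist z e ^ p)
      = 1 + ENNReal.ofReal (dist z e ^ p) := fun z => by
    rw [ENNReal.ofReal_add zero_le_one (by positivity), ENNReal.ofReal_one]
  simp only [h1]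
  rw [lintegral_add_left measurable_const]
  refine ENNReal.add_ne_top.2 ⟨by simp, h.ne⟩

lemma dsm_mem (e : Z) (p : ℝ) (ρ : Z → ℝ≥0) (hρ1 : ∀ z, ρ z ≤ 1)
    (μ : SignedMeasure Z) (h : MemMp e p μ) : MemMp e p (dsm ρ hρ1 μ) := by
  unfold MemMp at *
  rw [dsm_tv]
  refine (lintegral_mono' ?_ le_rfl).trans_lt h
  refine (withDensity_mono (Eventually.of_forall fun z => ?_)).trans_eq withDensity_one
  exact ENNReal.coe_le_coe.2 (hρ1 z)

lemma dsm_mom (e : Z) (p : ℝ) (hp : 1 ≤ p) (ρ ρ' : Z → ℝ≥0) (hρm : Measurable ρ)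
    (hρ1 : ∀ z, ρ z ≤ 1) (hρm' : Measurable ρ') (hρ1' : ∀ z, ρ' z ≤ 1)
    (hs : ∀ z, ρ z + ρ' z = 1) (μ : SignedMeasure Z) :
    momLint e p (dsm ρ hρ1 μ) + momLint e p (dsm ρ' hρ1' μ) = momLint e p μ := by
  unfold momLint
  rw [dsm_tv, dsm_tv, lintegral_withDensity_eq_lintegral_mul _ hρm.coe_nnreal_ennreal
    (mom_meas e p hp), lintegral_withDensity_eq_lintegral_mul _ hρm'.coe_nnreal_ennreal
    (mom_meas e p hp), ← lintegral_add_left (hρm.coe_nnreal_ennreal.mul (mom_meas e p hp))]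
  refine lintegral_congr fun z => ?_
  simp only [Pi.mul_apply]
  rw [← add_mul, ← ENNReal.coe_add, hs]
  simp

lemma dist_integrable (e : Z) (p : ℝ) (hp : 1 ≤ p) (μ : SignedMeasure Z) (h : MemMp e p μ) :
    Integrable (fun z => dist z e) μ.toJordanDecomposition.posPart ∧
    Integrable (fun z => dist z e) μ.toJordanDecomposition.negPart := by
  have h1 : Integrable (fun z => dist z e) μ.totalVariation := by
    refine ⟨(continuous_id.dist continuous_const).measurable.aestronglyMeasurable, ?_⟩
    refine lt_of_le_of_lt (lintegral_mono fun z => ?_) (momLint_ne_top e p μ h).lt_top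
    rw [Real.enorm_eq_ofReal dist_nonneg]
    refine ENNReal.ofReal_le_ofReal ?_
    rcases le_total (dist z e) 1 with h | h
    · have : 0 ≤ dist z e ^ p := by positivity
      linarith
    · have := Real.rpow_le_rpow_of_exponent_le h hp
      rw [Real.rpow_one] at this
      linarith
  unfold SignedMeasure.totalVariation at h1
  exact integrable_add_measure.1 h1

/-- The set in the definition of the KR norm. -/
def krSet (e : Z) (μ : SignedMeasure Z) : Set ℝ :=
  {r : ℝ | ∃ f : Z → ℝ, f e = 0 ∧ LipschitzWith 1 f ∧ r = sInteg μ f}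

lemma zero_mem_krSet (e : Z) (μ : SignedMeasure Z) : 0 ∈ krSet e μ :=
  ⟨fun _ => 0, rfl, LipschitzWith.const' 0, by simp [sInteg]⟩

lemma kruNorm_nonneg (e : Z) (μ : SignedMeasure Z) : 0 ≤ kruNorm e μ :=
  add_nonneg (abs_nonneg _) (Real.sSup_nonneg' ⟨0, zero_mem_krSet e μ, le_rfl⟩)

lemma krSet_bdd (e : Z) (p : ℝ) (hp : 1 ≤ p) (μ : SignedMeasure Z) (h : MemMp e p μ) :
    BddAbove (krSet e μ) := by
  obtain ⟨h1, h2⟩ := dist_integrable e p hp μ h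
  refine ⟨∫ z, dist z e ∂μ.toJordanDecomposition.posPart
    + ∫ z, dist z e ∂μ.toJordanDecomposition.negPart, ?_⟩
  rintro _ ⟨f, fe, hf, rfl⟩
  have hb : ∀ z, |f z| ≤ dist z e := fun z => by
    have := hf.dist_le_mul z e
    rw [Real.dist_eq, fe] at this
    simpa using this
  unfold sInteg
  have a1 := integral_mono (lip_integrable e _ h1 hf) h1 fun z => (le_abs_self _).trans (hb z)
  have a2 := integral_mono h2.neg (lip_integrable e _ h2 hf) fun z => (abs_le.1 (hb z)).1
  have a3 : ∫ z, (-fun z => dist z e) z ∂μ.toJordanDecomposition.negPart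
    = - ∫ z, dist z e ∂μ.toJordanDecomposition.negPart := integral_neg _
  rw [a3] at a2
  linarith

lemma tv_smul (r : ℝ≥0) (μ : SignedMeasure Z) :
    (r • μ).totalVariation = r • μ.totalVariation := by
  unfold SignedMeasure.totalVariation
  rw [SignedMeasure.toJordanDecomposition_smul, JordanDecomposition.smul_posPart,
    JordanDecomposition.smul_negPart, smul_add]

lemma memMp_smul (e : Z) (p : ℝ) (r : ℝ≥0) (μ : SignedMeasure Z) (h : MemMp e p μ) :
    MemMp e p (r • μ) := by
  unfold MemMp at *
  rw [tv_smul, lintegral_smul_measure]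
  exact ENNReal.mul_lt_top ENNReal.coe_lt_top h

lemma momLint_smul (e : Z) (p : ℝ) (r : ℝ≥0) (μ : SignedMeasure Z) :
    momLint e p (r • μ) = r * momLint e p μ := by
  unfold momLint
  rw [tv_smul, lintegral_smul_measure]
  rfl

lemma sInteg_smul (r : ℝ≥0) (μ : SignedMeasure Z) (f : Z → ℝ) :
    sInteg (r • μ) f = r * sInteg μ f := by
  unfold sInteg
  rw [SignedMeasure.toJordanDecomposition_smul, JordanDecomposition.smul_posPart,
    JordanDecomposition.smul_negPart, integral_smul_nnreal_measure, integral_smul_nnreal_measure,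
    NNReal.smul_def, NNReal.smul_def, smul_eq_mul, smul_eq_mul, mul_sub]

open scoped Pointwise in
lemma kruNorm_smul (e : Z) (r : ℝ≥0) (μ : SignedMeasure Z) :
    kruNorm e (r • μ) = r * kruNorm e μ := by
  have h : krSet e (r • μ) = (r : ℝ) • krSet e μ := by
    ext x
    constructor
    · rintro ⟨f, fe, hf, rfl⟩
      exact ⟨_, ⟨f, fe, hf, rfl⟩, (sInteg_smul r μ f).symm⟩
    · rintro ⟨_, ⟨f, fe, hf, rfl⟩, rfl⟩
      exact ⟨f, fe, hf, (sInteg_smul r μ f).symm⟩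
  change |(r • μ) Set.univ| + sSup (krSet e (r • μ)) = r * (|μ Set.univ| + sSup (krSet e μ))
  have h2 : sSup ((r : ℝ) • krSet e μ) = (r : ℝ) • sSup (krSet e μ) :=
    Real.sSup_smul_of_nonneg (NNReal.coe_nonneg r) _
  rw [h, h2, mul_add, smul_eq_mul]
  have : (r • μ) Set.univ = (r : ℝ) * μ Set.univ := rfl
  rw [this, abs_mul, NNReal.abs_eq]

/-- real-valued `G`. -/
def GG (e : Z) (p α β : ℝ) (μ : SignedMeasure Z) : ℝ :=
  α * kruNorm e μ + β * (momLint e p μ).toReal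

lemma GG_smul (e : Z) (p α β : ℝ) (r : ℝ≥0) (μ : SignedMeasure Z) :
    GG e p α β (r • μ) = r * GG e p α β μ := by
  unfold GG
  rw [kruNorm_smul, momLint_smul, ENNReal.toReal_mul, ENNReal.coe_toReal]
  ring

lemma GG_nonneg (e : Z) (p α β : ℝ) (hα : 0 < α) (hβ : 0 < β) (μ : SignedMeasure Z) :
    0 ≤ GG e p α β μ :=
  add_nonneg (mul_nonneg hα.le (kruNorm_nonneg e μ)) (mul_nonneg hβ.le ENNReal.toReal_nonneg)

lemma GG_eq_zero (e : Z) (p α β : ℝ) (hp : 1 ≤ p) (hα : 0 < α) (hβ : 0 < β)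
    (μ : SignedMeasure Z) (hm : MemMp e p μ) (h : GG e p α β μ ≤ 0) : μ = 0 := by
  have h1 : (momLint e p μ).toReal = 0 := by
    have a := mul_nonneg hα.le (kruNorm_nonneg e μ)
    have b : 0 ≤ (momLint e p μ).toReal := ENNReal.toReal_nonneg
    unfold GG at h
    nlinarith
  have h2 : momLint e p μ = 0 :=
    (ENNReal.toReal_eq_zero_iff _).1 h1 |>.resolve_right (momLint_ne_top e p μ hm)
  have h3 : μ.totalVariation Set.univ = 0 := by
    refine le_antisymm ?_ bot_le
    rw [← h2, momLint, ← lintegral_one]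
    refine lintegral_mono fun z => ?_
    rw [← ENNReal.ofReal_one]
    refine ENNReal.ofReal_le_ofReal ?_
    have : 0 ≤ dist z e ^ p := by positivity
    linarith
  ext A hA
  have h4 : μ.totalVariation A = 0 := measure_mono_null (Set.subset_univ A) h3
  simpa using SignedMeasure.null_of_totalVariation_zero μ h4

lemma tv_neg (e : Z) (μ : SignedMeasure Z) (p α β : ℝ) :
    (MemMp e p (-μ) ↔ MemMp e p μ) ∧ GG e p α β (-μ) = GG e p α β μ := by
  have h : krSet e (-μ) = krSet e μ := by
    have key : ∀ μ : SignedMeasure Z, krSet e (-μ) ⊆ krSet e μ := by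
      rintro μ _ ⟨f, fe, hf, rfl⟩
      refine ⟨fun z => -f z, by simp [fe], hf.neg, ?_⟩
      unfold sInteg
      rw [SignedMeasure.toJordanDecomposition_neg, integral_neg, integral_neg]
      simp only [JordanDecomposition.neg_posPart, JordanDecomposition.neg_negPart]
      ring
    refine (key μ).antisymm ?_
    simpa using key (-μ)
  unfold MemMp GG momLint
  rw [SignedMeasure.totalVariation_neg]
  refine ⟨Iff.rfl, ?_⟩
  change α * (|(-μ) Set.univ| + sSup (krSet e (-μ))) + _
    = α * (|μ Set.univ| + sSup (krSet e μ)) + _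
  rw [h]
  have : (-μ) Set.univ = -(μ Set.univ) := rfl
  rw [this, abs_neg]

/-- The unit ball. -/
def Ball (e : Z) (p α β : ℝ) : Set (SignedMeasure Z) := {μ | MemMp e p μ ∧ GG e p α β μ ≤ 1}

lemma ext_prop (e : Z) (p α β : ℝ) (hp : 1 ≤ p) (hα : 0 < α) (hβ : 0 < β)
    (μ μ₁ μ₂ : SignedMeasure Z) (hμ : μ ∈ Set.extremePoints ℝ (Ball e p α β))
    (h₁ : MemMp e p μ₁) (h₂ : MemMp e p μ₂) (hs : μ₁ + μ₂ = μ)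
    (hG : GG e p α β μ₁ + GG e p α β μ₂ ≤ 1) : ∃ s : ℝ, μ₁ = s • μ := by
  have n1 := GG_nonneg e p α β hα hβ μ₁
  have n2 := GG_nonneg e p α β hα hβ μ₂
  rcases n1.eq_or_lt with h0 | h0
  · exact ⟨0, by rw [zero_smul]; exact GG_eq_zero e p α β hp hα hβ μ₁ h₁ h0.symm.le⟩
  rcases le_or_gt 1 (GG e p α β μ₁) with h1 | h1
  · refine ⟨1, ?_⟩
    have : μ₂ = 0 := GG_eq_zero e p α β hp hα hβ μ₂ h₂ (by linarith)
    rw [one_smul, ← hs, this, add_zero]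
  obtain ⟨s, hs'⟩ : ∃ s : ℝ≥0, (s : ℝ) = GG e p α β μ₁ := ⟨⟨_, n1⟩, rfl⟩
  obtain ⟨t, ht'⟩ : ∃ t : ℝ≥0, (t : ℝ) = 1 - GG e p α β μ₁ := ⟨⟨_, by linarith⟩, rfl⟩
  have s0 : (0:ℝ) < s := by rw [hs']; exact h0
  have t0 : (0:ℝ) < t := by rw [ht']; linarith
  have sn : s ≠ 0 := by rintro rfl; simp at s0
  have tn : t ≠ 0 := by rintro rfl; simp at t0
  have m1 : s⁻¹ • μ₁ ∈ Ball e p α β := by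
    refine ⟨memMp_smul e p _ _ h₁, ?_⟩
    rw [GG_smul, ← hs', NNReal.coe_inv, inv_mul_cancel₀ s0.ne']
  have m2 : t⁻¹ • μ₂ ∈ Ball e p α β := by
    refine ⟨memMp_smul e p _ _ h₂, ?_⟩
    rw [GG_smul, NNReal.coe_inv, inv_mul_le_iff₀ t0, ht']
    linarith
  have := (mem_extremePoints.1 hμ).2 _ m1 _ m2 ⟨s, t, s0, t0, by rw [hs', ht']; ring, by
    change s • s⁻¹ • μ₁ + t • t⁻¹ • μ₂ = μ
    rw [smul_inv_smul₀ sn, smul_inv_smul₀ tn, hs]⟩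
  refine ⟨s, ?_⟩
  change μ₁ = s • μ
  rw [← this.1, smul_inv_smul₀ sn]

lemma nn_sub (c : ℝ) : (c.toNNReal : ℝ) - ((-c).toNNReal : ℝ) = c := by
  rw [Real.coe_toNNReal', Real.coe_toNNReal']
  exact max_zero_sub_max_neg_zero_eq_self c

lemma diracSM_apply (x : Z) (A : Set Z) (hA : MeasurableSet A) :
    diracSM x A = (Measure.dirac x).real A := by
  unfold diracSM
  rw [Measure.toSignedMeasure_apply_measurable hA]

/-- Subtracting a Dirac mass. -/
lemma sub_dirac (e : Z) (c : ℝ) (μ : SignedMeasure Z) :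
    μ - c • diracSM e =
      (μ.toJordanDecomposition.posPart + (-c).toNNReal • Measure.dirac e).toSignedMeasure
      - (μ.toJordanDecomposition.negPart + c.toNNReal • Measure.dirac e).toSignedMeasure := by
  ext A hA
  rw [Measure.toSignedMeasure_sub_apply hA, measureReal_add_apply, measureReal_add_apply,
    _root_.sub_apply, _root_.smul_apply, diracSM_apply e A hA,
    SignedMeasure.apply_eq_posPart_real_sub_negPart_real μ hA, measureReal_nnreal_smul_apply,
    measureReal_nnreal_smul_apply, smul_eq_mul]
  have := nn_sub c
  conv_lhs => rw [← this]
  ring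

lemma int_dirac (e : Z) (r : ℝ≥0) (f : Z → ℝ) : Integrable f (r • Measure.dirac e) := by
  have h : Integrable f (Measure.dirac e) := integrable_dirac (by simp)
  exact h.smul_measure_nnreal

lemma sInteg_sub_dirac (e : Z) (c : ℝ) (μ : SignedMeasure Z) (f : Z → ℝ)
    (h1 : Integrable f μ.toJordanDecomposition.posPart)
    (h2 : Integrable f μ.toJordanDecomposition.negPart) :
    Integrable f (μ - c • diracSM e).toJordanDecomposition.posPart ∧
    Integrable f (μ - c • diracSM e).toJordanDecomposition.negPart ∧
    sInteg μ f = sInteg (μ - c • diracSM e) f + c * f e := by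
  obtain ⟨hp, hn, hf⟩ := sInteg_sub _ _ _ (sub_dirac e c μ)
  have i1 := h1.add_measure (int_dirac e (-c).toNNReal f)
  have i2 := h2.add_measure (int_dirac e c.toNNReal f)
  refine ⟨i1.mono_measure hp, i2.mono_measure hn, ?_⟩
  rw [hf f i1 i2, integral_add_measure h1 (int_dirac _ _ _),
    integral_add_measure h2 (int_dirac _ _ _), integral_smul_nnreal_measure,
    integral_smul_nnreal_measure, integral_dirac, NNReal.smul_def, NNReal.smul_def,
    smul_eq_mul, smul_eq_mul]
  have := nn_sub c
  unfold sInteg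
  linear_combination (f e) * this

lemma kru_split (e : Z) (p : ℝ) (hp : 1 ≤ p) (μ : SignedMeasure Z) (hμ : MemMp e p μ)
    (H B : Set Z) (hH : MeasurableSet H) (hB : MeasurableSet B)
    (hPH : (μ - μ Set.univ • diracSM e).toJordanDecomposition.posPart Hᶜ = 0)
    (hQH : (μ - μ Set.univ • diracSM e).toJordanDecomposition.negPart H = 0) :
    ∃ (ρ ρ' : Z → ℝ≥0) (_ : Measurable ρ) (hρ1 : ∀ z, ρ z ≤ 1) (_ : Measurable ρ')
      (hρ1' : ∀ z, ρ' z ≤ 1), (∀ z, ρ z + ρ' z = 1) ∧ (∀ z ∈ H ∩ B, ρ z = 1) ∧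
      (∀ z ∈ H ∩ Bᶜ, ρ z = 0) ∧
      dsm ρ hρ1 μ Set.univ = μ Set.univ * ρ e ∧
      kruNorm e (dsm ρ hρ1 μ) + kruNorm e (dsm ρ' hρ1' μ) ≤ kruNorm e μ := by
  set c := μ Set.univ with hc
  set ν := μ - c • diracSM e with hν
  set P := ν.toJordanDecomposition.posPart with hP
  set Q := ν.toJordanDecomposition.negPart with hQ
  obtain ⟨d1, d2⟩ := dist_integrable e p hp μ hμ
  obtain ⟨dP, dQ, -⟩ := sInteg_sub_dirac e c μ _ d1 d2
  have hbal : P.real Set.univ = Q.real Set.univ := by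
    have h1 := SignedMeasure.apply_eq_posPart_real_sub_negPart_real ν MeasurableSet.univ
    have h2 : ν Set.univ = 0 := by
      rw [hν, _root_.sub_apply, _root_.smul_apply, diracSM_apply e _ MeasurableSet.univ]
      simp [hc]
    rw [h2] at h1
    linarith
  have hsup : ∀ f : Z → ℝ, LipschitzWith 1 f →
      ∫ z, f z ∂P - ∫ z, f z ∂Q ≤ sSup (krSet e μ) := by
    intro f hf
    have hf0 : LipschitzWith 1 (fun z => f z - f e) := by
      refine LipschitzWith.of_dist_le_mul fun x y => ?_
      rw [dist_sub_right]
      exact hf.dist_le_mul x y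
    have h1 := le_csSup (krSet_bdd e p hp μ hμ) ⟨_, sub_self (f e), hf0, rfl⟩
    rw [(sInteg_sub_dirac e c μ _ (lip_integrable e _ d1 hf0) (lip_integrable e _ d2 hf0)).2.2]
      at h1
    simp only [sub_self, mul_zero, add_zero] at h1
    unfold sInteg at h1
    rw [← hν, ← hP, ← hQ, integral_sub (lip_integrable e _ dP hf) (integrable_const _),
      integral_sub (lip_integrable e _ dQ hf) (integrable_const _)] at h1
    simp only [integral_const] at h1
    have h1' : (∫ z, f z ∂P - P.real Set.univ • f e) - (∫ z, f z ∂Q - Q.real Set.univ • f e)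
        ≤ sSup (krSet e μ) := h1
    rw [hbal] at h1'
    linarith
  obtain ⟨g, hgm, hg0, hg1, hg⟩ := split_lemma e P Q dP dQ _ hsup B hB
  let ρ : Z → ℝ≥0 := fun z => if z ∈ H then (if z ∈ B then 1 else 0) else (g z).toNNReal
  have hρm : Measurable ρ :=
    Measurable.ite hH (Measurable.ite hB measurable_const measurable_const) hgm.real_toNNReal
  have hρ1 : ∀ z, ρ z ≤ 1 := by
    intro z
    simp only [ρ]
    split_ifs
    · exact le_rfl
    · exact zero_le_one
    · exact Real.toNNReal_le_one.2 (hg1 z)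
  let ρ' : Z → ℝ≥0 := fun z => 1 - ρ z
  have hρm' : Measurable ρ' := measurable_const.sub hρm
  have hρ1' : ∀ z, ρ' z ≤ 1 := fun z => tsub_le_self
  have hsum : ∀ z, ρ z + ρ' z = 1 := fun z => add_tsub_cancel_of_le (hρ1 z)
  have hsumR : ∀ z, (ρ' z : ℝ) = 1 - ρ z := fun z => by
    have : (ρ z : ℝ) + ρ' z = 1 := by exact_mod_cast hsum z
    linarith
  have aeP : ∀ᵐ z ∂P, (ρ z : ℝ) = B.indicator (fun _ => 1) z := by
    have : ∀ᵐ z ∂P, z ∈ H := hPH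
    filter_upwards [this] with z hz
    by_cases hzB : z ∈ B <;> simp [ρ, hz, hzB]
  have aeQ : ∀ᵐ z ∂Q, (ρ z : ℝ) = g z := by
    have : ∀ᵐ z ∂Q, z ∉ H := by
      rw [ae_iff]; simpa using hQH
    filter_upwards [this] with z hz
    simp [ρ, hz, hg0 z]
  have iP1 : ∀ f : Z → ℝ, ∫ z, ρ z * f z ∂P = ∫ z in B, f z ∂P := by
    intro f
    rw [← integral_indicator hB]
    refine integral_congr_ae ?_
    filter_upwards [aeP] with z hz
    rw [hz]
    by_cases hzB : z ∈ B <;> simp [hzB]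
  have iP2 : ∀ f : Z → ℝ, ∫ z, ρ' z * f z ∂P = ∫ z in Bᶜ, f z ∂P := by
    intro f
    rw [← integral_indicator hB.compl]
    refine integral_congr_ae ?_
    filter_upwards [aeP] with z hz
    rw [hsumR, hz]
    by_cases hzB : z ∈ B <;> simp [hzB]
  have iQ : ∀ f₁ f₂ : Z → ℝ, LipschitzWith 1 f₁ → LipschitzWith 1 f₂ →
      ∫ z, ρ z * f₁ z ∂Q + ∫ z, ρ' z * f₂ z ∂Q
        = ∫ z, (g z * f₁ z + (1 - g z) * f₂ z) ∂Q := by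
    intro f₁ f₂ h₁ h₂
    rw [← integral_add (bdd_int ρ hρm hρ1 Q (lip_integrable e _ dQ h₁))
      (bdd_int ρ' hρm' hρ1' Q (lip_integrable e _ dQ h₂))]
    refine integral_congr_ae ?_
    filter_upwards [aeQ] with z hz
    rw [hsumR, hz]
  have key : ∀ f₁ f₂ : Z → ℝ, LipschitzWith 1 f₁ → LipschitzWith 1 f₂ →
      sInteg ν (fun z => ρ z * f₁ z) + sInteg ν (fun z => ρ' z * f₂ z) ≤ sSup (krSet e μ) := by
    intro f₁ f₂ h₁ h₂
    have h3 := hg f₁ f₂ h₁ h₂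
    rw [← iQ f₁ f₂ h₁ h₂, ← iP1, ← iP2] at h3
    unfold sInteg
    rw [← hP, ← hQ]
    linarith
  have hz0 : sInteg ν (fun z => (ρ z : ℝ)) = 0 := by
    have hk : ∀ k : ℝ, k * sInteg ν (fun z => (ρ z : ℝ)) ≤ sSup (krSet e μ) := by
      intro k
      have := key (fun _ => k) (fun _ => 0) (LipschitzWith.const' k) (LipschitzWith.const' 0)
      unfold sInteg at this ⊢
      simp only [mul_zero, integral_zero, sub_zero, add_zero, integral_mul_const] at this
      linarith
    by_contra hne
    have := hk ((sSup (krSet e μ) + 1) / sInteg ν (fun z => (ρ z : ℝ)))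
    rw [div_mul_cancel₀ _ hne] at this
    linarith
  have hmass : dsm ρ hρ1 μ Set.univ = c * ρ e := by
    rw [dsm_apply ρ hρm hρ1 μ _ MeasurableSet.univ, Set.indicator_univ,
      (sInteg_sub_dirac e c μ _ (bdd_int' ρ hρm hρ1 _) (bdd_int' ρ hρm hρ1 _)).2.2, ← hν, hz0,
      zero_add]
  have hmass' : dsm ρ' hρ1' μ Set.univ = c * ρ' e := by
    have h1 := congrArg (fun m : SignedMeasure Z => m Set.univ)
      (dsm_add ρ ρ' hρm hρ1 hρm' hρ1' hsum μ)
    simp only [_root_.add_apply] at h1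
    rw [hmass, ← hc] at h1
    rw [hsumR]
    linarith
  have hI : ∀ (σ : Z → ℝ≥0) (hσm : Measurable σ) (hσ1 : ∀ z, σ z ≤ 1) (f : Z → ℝ),
      LipschitzWith 1 f → f e = 0 →
      sInteg (dsm σ hσ1 μ) f = sInteg ν (fun z => σ z * f z) := by
    intro σ hσm hσ1 f hf fe
    rw [dsm_sInteg σ hσm, (sInteg_sub_dirac e c μ _
      (bdd_int σ hσm hσ1 _ (lip_integrable e _ d1 hf))
      (bdd_int σ hσm hσ1 _ (lip_integrable e _ d2 hf))).2.2, fe, mul_zero, mul_zero, add_zero]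
  refine ⟨ρ, ρ', hρm, hρ1, hρm', hρ1', hsum, ?_, ?_, hmass, ?_⟩
  · rintro z ⟨h1, h2⟩
    simp [ρ, h1, h2]
  · rintro z ⟨h1, h2⟩
    have h2' : z ∉ B := h2
    simp [ρ, h1, h2']
  · change |dsm ρ hρ1 μ Set.univ| + sSup (krSet e (dsm ρ hρ1 μ))
      + (|dsm ρ' hρ1' μ Set.univ| + sSup (krSet e (dsm ρ' hρ1' μ)))
      ≤ |c| + sSup (krSet e μ)
    rw [hmass, hmass', abs_mul, abs_mul, NNReal.abs_eq, NNReal.abs_eq, hsumR e]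
    have : sSup (krSet e (dsm ρ hρ1 μ)) ≤ sSup (krSet e μ) - sSup (krSet e (dsm ρ' hρ1' μ)) := by
      refine csSup_le ⟨0, zero_mem_krSet _ _⟩ ?_
      rintro _ ⟨f₁, e₁, h₁, rfl⟩
      rw [le_sub_comm]
      refine csSup_le ⟨0, zero_mem_krSet _ _⟩ ?_
      rintro _ ⟨f₂, e₂, h₂, rfl⟩
      rw [hI ρ hρm hρ1 f₁ h₁ e₁, hI ρ' hρm' hρ1' f₂ h₂ e₂]
      linarith [key f₁ f₂ h₁ h₂]
    linarith

lemma ext_zero_one (e : Z) (p α β : ℝ) (hp : 1 ≤ p) (hα : 0 < α) (hβ : 0 < β)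
    (μ : SignedMeasure Z) (hμ : μ ∈ Set.extremePoints ℝ (Ball e p α β))
    (B : Set Z) (hB : MeasurableSet B) :
    (μ - μ Set.univ • diracSM e).toJordanDecomposition.posPart B = 0 ∨
    (μ - μ Set.univ • diracSM e).toJordanDecomposition.posPart Bᶜ = 0 := by
  obtain ⟨Hc, hHc, hPH, hQH⟩ :=
    (μ - μ Set.univ • diracSM e).toJordanDecomposition.mutuallySingular
  obtain ⟨ρ, ρ', hρm, hρ1, hρm', hρ1', hsum, hB1, hB0, hmass, hkru⟩ :=
    kru_split e p hp μ hμ.1.1 Hcᶜ B hHc.compl hB (by rwa [compl_compl]) hQH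
  set c := μ Set.univ with hc
  set ν := μ - c • diracSM e with hν
  set P := ν.toJordanDecomposition.posPart with hP
  set Q := ν.toJordanDecomposition.negPart with hQ
  have hm := dsm_mom e p hp ρ ρ' hρm hρ1 hρm' hρ1' hsum μ
  have mm1 := dsm_mem e p ρ hρ1 μ hμ.1.1
  have mm2 := dsm_mem e p ρ' hρ1' μ hμ.1.1
  obtain ⟨s, hs⟩ := ext_prop e p α β hp hα hβ μ (dsm ρ hρ1 μ) (dsm ρ' hρ1' μ) hμ mm1 mm2
    (dsm_add ρ ρ' hρm hρ1 hρm' hρ1' hsum μ) (by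
      refine le_trans ?_ hμ.1.2
      unfold GG
      rw [← hm, ENNReal.toReal_add (momLint_ne_top e p _ mm1) (momLint_ne_top e p _ mm2)]
      have := mul_le_mul_of_nonneg_left hkru hα.le
      linarith)
  have hcs : c * ρ e = s * c := by
    rw [← hmass, hs]; rfl
  have key : ∀ A, MeasurableSet A →
      sInteg ν (A.indicator fun z => (ρ z : ℝ)) = s * ν A := by
    intro A hA
    have hi : ∀ M : Measure Z, IsFiniteMeasure M →
        Integrable (A.indicator fun z => (ρ z : ℝ)) M := fun M _ =>
      (bdd_int' ρ hρm hρ1 M).indicator hA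
    have h1 := (sInteg_sub_dirac e c μ _ (hi _ inferInstance) (hi _ inferInstance)).2.2
    rw [← hν, ← dsm_apply ρ hρm hρ1 μ A hA, hs, _root_.smul_apply, smul_eq_mul] at h1
    have h2 : ν A = μ A - c * (Measure.dirac e).real A := by
      rw [hν, _root_.sub_apply, _root_.smul_apply, diracSM_apply e A hA, smul_eq_mul]
    have h3 : A.indicator (fun z => (ρ z : ℝ)) e = (Measure.dirac e).real A * ρ e := by
      by_cases h : e ∈ A <;> simp [h, Measure.real]
    rw [h3] at h1
    rw [h2]
    linear_combination (-1 : ℝ) * h1 - (Measure.dirac e).real A * hcs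
  have hPA : ∀ A, MeasurableSet A → P.real (Hcᶜ ∩ A) = P.real A := by
    intro A hA
    have : P A = P (Hcᶜ ∩ A) := by
      rw [Set.inter_comm, ← Set.sdiff_eq, measure_sdiff_null hPH]
    rw [Measure.real, Measure.real, this]
  have hνA : ∀ A, MeasurableSet A → ν (Hcᶜ ∩ A) = P.real A := by
    intro A hA
    rw [SignedMeasure.apply_eq_posPart_real_sub_negPart_real ν (hHc.compl.inter hA), ← hP, ← hQ,
      hPA A hA]
    have : Q (Hcᶜ ∩ A) = 0 := measure_mono_null Set.inter_subset_left hQH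
    rw [Measure.real, Measure.real, this]
    simp
  have e1 := key _ (hHc.compl.inter hB)
  have e2 := key _ (hHc.compl.inter hB.compl)
  have f1 : (Hcᶜ ∩ B).indicator (fun z => (ρ z : ℝ)) = (Hcᶜ ∩ B).indicator (fun _ => 1) := by
    refine Set.indicator_congr fun z hz => ?_
    rw [hB1 z hz, NNReal.coe_one]
  have f2 : (Hcᶜ ∩ Bᶜ).indicator (fun z => (ρ z : ℝ)) = fun _ => 0 := by
    ext z
    by_cases h : z ∈ Hcᶜ ∩ Bᶜ
    · rw [Set.indicator_of_mem h, hB0 z h, NNReal.coe_zero]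
    · rw [Set.indicator_of_notMem h]
  rw [f1, ← sInteg_indicator ν _ (hHc.compl.inter hB), hνA B hB] at e1
  rw [f2, hνA _ hB.compl] at e2
  have e3 : sInteg ν (fun _ => 0) = 0 := by simp [sInteg]
  rw [e3] at e2
  by_cases h : P.real B = 0
  · left
    rwa [measureReal_eq_zero_iff] at h
  · right
    have s1 : s = 1 := mul_right_cancel₀ h (by linarith)
    rw [s1, one_mul] at e2
    exact (measureReal_eq_zero_iff).1 e2.symm

lemma neg_smul_sm (c : ℝ) (μ : SignedMeasure Z) : (-c) • μ = -(c • μ) := by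
  ext A hA
  change (-c) * μ A = -(c * μ A)
  ring

lemma exists_dirac [CompleteSpace Z] [TopologicalSpace.SeparableSpace Z]
    (P : Measure Z) [IsFiniteMeasure P]
    (h : ∀ B, MeasurableSet B → P B = 0 ∨ P Bᶜ = 0) (hP : P ≠ 0) :
    ∃ x, ∀ A, MeasurableSet A → P.real A = P.real Set.univ * (Measure.dirac x).real A := by
  have : SecondCountableTopology Z := UniformSpace.secondCountable_of_separable Z
  have : PolishSpace Z := inferInstance
  have hu : P Set.univ ≠ 0 := by rwa [Ne, Measure.measure_univ_eq_zero]
  have hu' : P Set.univ ≠ ⊤ := measure_ne_top _ _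
  let M := (P Set.univ)⁻¹ • P
  have hMu : M Set.univ = 1 := by
    simp only [M, Measure.smul_apply, smul_eq_mul]
    exact ENNReal.inv_mul_cancel hu hu'
  have : IsZeroOneMeasure M := ⟨fun s hs => by
    rcases h s hs with h | h
    · left; simp [M, h]
    · right
      rw [← hMu]
      have h2 : M sᶜ = 0 := by simp [M, h]
      rw [← measure_add_measure_compl hs, h2, add_zero]⟩
  have : NeZero M := ⟨fun h0 => by rw [h0] at hMu; simp at hMu⟩
  obtain ⟨x, hx⟩ := IsZeroOneMeasure.exists_eq_dirac (μ := M)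
  refine ⟨x, fun A hA => ?_⟩
  rw [← hx]
  simp only [Measure.real, M, Measure.smul_apply, smul_eq_mul, ENNReal.toReal_mul,
    ENNReal.toReal_inv]
  rw [mul_inv_cancel_left₀]
  exact ENNReal.toReal_ne_zero.2 ⟨hu, hu'⟩

lemma memMp_zero (e : Z) (p : ℝ) : MemMp e p (0 : SignedMeasure Z) := by
  unfold MemMp
  rw [SignedMeasure.totalVariation_zero]
  simp

lemma GG_zero (e : Z) (p α β : ℝ) : GG e p α β (0 : SignedMeasure Z) = 0 := by
  have := GG_smul e p α β 0 (0 : SignedMeasure Z)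
  rwa [smul_zero, NNReal.coe_zero, zero_mul] at this

lemma memMp_dirac (e : Z) (p : ℝ) : MemMp e p (diracSM e) := by
  obtain ⟨h1, h2, -⟩ := sInteg_sub (Measure.dirac e) 0 (diracSM e) (by simp [diracSM])
  unfold MemMp SignedMeasure.totalVariation
  refine lt_of_le_of_lt (lintegral_mono' (add_le_add h1 h2) le_rfl) ?_
  rw [add_zero, lintegral_dirac]
  exact ENNReal.ofReal_lt_top

lemma neg_ext (e : Z) (p α β : ℝ) (μ : SignedMeasure Z)
    (hμ : μ ∈ Set.extremePoints ℝ (Ball e p α β)) :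
    -μ ∈ Set.extremePoints ℝ (Ball e p α β) := by
  have hneg : ∀ μ : SignedMeasure Z, μ ∈ Ball e p α β → -μ ∈ Ball e p α β := by
    rintro μ ⟨h1, h2⟩
    obtain ⟨h3, h4⟩ := tv_neg e μ p α β
    exact ⟨h3.2 h1, h4.trans_le h2⟩
  rw [mem_extremePoints] at hμ ⊢
  refine ⟨hneg _ hμ.1, fun x hx y hy hxy => ?_⟩
  obtain ⟨s, t, hs, ht, hst, h⟩ := hxy
  have := hμ.2 _ (hneg x hx) _ (hneg y hy) ⟨s, t, hs, ht, hst, by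
    rw [smul_neg, smul_neg, ← neg_add, h, neg_neg]⟩
  exact ⟨neg_eq_iff_eq_neg.1 this.1, neg_eq_iff_eq_neg.1 this.2⟩

lemma ext_GG_eq_one (e : Z) (p α β : ℝ) (hp : 1 ≤ p) (hα : 0 < α) (hβ : 0 < β)
    (μ : SignedMeasure Z) (hμ : μ ∈ Set.extremePoints ℝ (Ball e p α β)) :
    GG e p α β μ = 1 := by
  have hne : μ ≠ 0 := by
    rintro rfl
    have g0 := GG_nonneg e p α β hα hβ (diracSM e)
    obtain ⟨t, ht⟩ : ∃ t : ℝ≥0, (t : ℝ) = (1 + GG e p α β (diracSM e))⁻¹ :=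
      ⟨⟨_, by positivity⟩, rfl⟩
    have m1 : t • diracSM e ∈ Ball e p α β := by
      refine ⟨memMp_smul e p _ _ (memMp_dirac e p), ?_⟩
      rw [GG_smul, ht, inv_mul_le_iff₀ (by positivity)]
      linarith
    have m2 : -(t • diracSM e) ∈ Ball e p α β := by
      obtain ⟨h3, h4⟩ := tv_neg e (t • diracSM e) p α β
      exact ⟨h3.2 m1.1, h4.trans_le m1.2⟩
    have := ((mem_extremePoints.1 hμ).2 _ m1 _ m2 ⟨1 / 2, 1 / 2, by norm_num, by norm_num,
      by norm_num, by rw [smul_neg, add_neg_cancel]⟩).1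
    have h5 : (t • diracSM e) Set.univ = (t : ℝ) * diracSM e Set.univ := rfl
    rw [this, diracSM_apply e _ MeasurableSet.univ] at h5
    have h6 : (t : ℝ) = 0 := by simpa using h5.symm
    rw [ht] at h6
    have : 0 < (1 + GG e p α β (diracSM e))⁻¹ := by positivity
    linarith
  have hpos : 0 < GG e p α β μ := by
    by_contra h
    exact hne (GG_eq_zero e p α β hp hα hβ μ hμ.1.1 (not_lt.1 h))
  refine le_antisymm hμ.1.2 (not_lt.1 fun hlt => ?_)
  obtain ⟨s, hs⟩ : ∃ s : ℝ≥0, (s : ℝ) = GG e p α β μ := ⟨⟨_, hpos.le⟩, rfl⟩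
  have s0 : (0 : ℝ) < s := by rw [hs]; exact hpos
  have sn : s ≠ 0 := by rintro rfl; simp at s0
  have m1 : s⁻¹ • μ ∈ Ball e p α β := by
    refine ⟨memMp_smul e p _ _ hμ.1.1, ?_⟩
    rw [GG_smul, ← hs, NNReal.coe_inv, inv_mul_cancel₀ s0.ne']
  have m2 : (0 : SignedMeasure Z) ∈ Ball e p α β :=
    ⟨memMp_zero e p, by rw [GG_zero]; exact zero_le_one⟩
  have := (mem_extremePoints.1 hμ).2 _ m1 _ m2 ⟨s, 1 - s, s0, by rw [hs]; linarith, by ring, by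
    rw [smul_zero, add_zero]
    change s • s⁻¹ • μ = μ
    rw [smul_inv_smul₀ sn]⟩
  exact hne this.2.symm

lemma kru_dirac (e x y : Z) (a c : ℝ) (ha : 0 < a) (ν μ : SignedMeasure Z)
    (hν : ν = a • diracSM x - a • diracSM y) (hμ : ν = μ - c • diracSM e)
    (hc : μ Set.univ = c) :
    kruNorm e μ = a * dist x y + |c| := by
  obtain ⟨r, hr⟩ : ∃ r : ℝ≥0, (r : ℝ) = a := ⟨⟨a, ha.le⟩, rfl⟩
  have hν' : ν = (r • Measure.dirac x).toSignedMeasure - (r • Measure.dirac y).toSignedMeasure := by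
    ext A hA
    rw [Measure.toSignedMeasure_sub_apply hA, hν, _root_.sub_apply, _root_.smul_apply,
      _root_.smul_apply, diracSM_apply _ A hA, diracSM_apply _ A hA,
      measureReal_nnreal_smul_apply, measureReal_nnreal_smul_apply, smul_eq_mul, smul_eq_mul, hr]
  have hμ' : μ = ν - (-c) • diracSM e := by
    rw [hμ, neg_smul_sm, sub_neg_eq_add, sub_add_cancel]
  obtain ⟨hp, hn, hf⟩ := sInteg_sub _ _ _ hν'
  have hI : ∀ f : Z → ℝ, f e = 0 → sInteg μ f = a * (f x - f y) := by
    intro f fe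
    have h1 := (sInteg_sub_dirac e (-c) ν f ((int_dirac x r f).mono_measure hp)
      ((int_dirac y r f).mono_measure hn)).2.2
    rw [← hμ', fe, mul_zero, add_zero, hf f (int_dirac x r f) (int_dirac y r f),
      integral_smul_nnreal_measure, integral_smul_nnreal_measure, integral_dirac, integral_dirac,
      NNReal.smul_def, NNReal.smul_def, smul_eq_mul, smul_eq_mul, hr] at h1
    rw [← h1]
    ring
  change |μ Set.univ| + sSup (krSet e μ) = _
  have hs : IsGreatest (krSet e μ) (a * dist x y) := by
    constructor
    · refine ⟨fun z => dist z y - dist e y, sub_self _, ?_, ?_⟩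
      · refine LipschitzWith.of_dist_le_mul fun z w => ?_
        rw [dist_sub_right]
        exact (LipschitzWith.dist_left y).dist_le_mul z w
      · rw [hI _ (sub_self _), dist_self]
        ring
    · rintro _ ⟨f, fe, hf, rfl⟩
      rw [hI f fe]
      refine mul_le_mul_of_nonneg_left ?_ ha.le
      have := hf.dist_le_mul x y
      rw [NNReal.coe_one, one_mul, Real.dist_eq] at this
      exact (le_abs_self _).trans this
  rw [hs.csSup_eq, hc, add_comm]

/-- Every extremal point `μ` of
`B_{α,β} = {μ ∈ M_p(Z) : G_{α,β}(μ) ≤ 1}` is of the form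
`μ = a δ_x − a δ_y + μ(Z) δ_e` with `x, y ∈ Z` and `a > 0` a normalizing constant
satisfying `1 = α (a d(x,y) + |μ(Z)|) + β ∫ (1 + d(z,e)^p) d|a δ_x − a δ_y + μ(Z) δ_e|`. -/
theorem extremePoints_Gab_ball [LocallyCompactSpace Z] [CompleteSpace Z]
    [TopologicalSpace.SeparableSpace Z] (hgeo : IsGeodesic Z) (e : Z)
    (p α β : ℝ) (hp : 1 ≤ p) (hα : 0 < α) (hβ : 0 < β) :
    ∀ μ ∈ Set.extremePoints ℝ
        {μ : SignedMeasure Z | MemMp e p μ ∧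
          α * kruNorm e μ + β * (momLint e p μ).toReal ≤ 1},
      ∃ (x y : Z) (a : ℝ), 0 < a ∧
        μ = a • diracSM x - a • diracSM y + μ Set.univ • diracSM e ∧
        1 = α * (a * dist x y + |μ Set.univ|) +
            β * (momLint e p
                (a • diracSM x - a • diracSM y + μ Set.univ • diracSM e)).toReal := by
  intro μ hμ0
  have hμ : μ ∈ Set.extremePoints ℝ (Ball e p α β) := hμ0
  have hG := ext_GG_eq_one e p α β hp hα hβ μ hμ
  suffices h : ∃ (x y : Z) (a : ℝ), 0 < a ∧
      μ - μ Set.univ • diracSM e = a • diracSM x - a • diracSM y by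
    obtain ⟨x, y, a, ha, h⟩ := h
    have h1 : μ = a • diracSM x - a • diracSM y + μ Set.univ • diracSM e := sub_eq_iff_eq_add.1 h
    refine ⟨x, y, a, ha, h1, ?_⟩
    rw [← h1, ← kru_dirac e x y a (μ Set.univ) ha _ μ h rfl rfl]
    exact hG.symm
  have hz1 := ext_zero_one e p α β hp hα hβ μ hμ
  have hz2 := ext_zero_one e p α β hp hα hβ (-μ) (neg_ext e p α β μ hμ)
  have hn : -μ - (-μ) Set.univ • diracSM e = -(μ - μ Set.univ • diracSM e) := by
    have : (-μ) Set.univ = -(μ Set.univ) := rfl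
    rw [this, neg_smul_sm]
    abel
  rw [hn, SignedMeasure.toJordanDecomposition_neg] at hz2
  simp only [JordanDecomposition.neg_posPart] at hz2
  have hν0 : (μ - μ Set.univ • diracSM e) Set.univ = 0 := by
    rw [_root_.sub_apply, _root_.smul_apply, diracSM_apply e _ MeasurableSet.univ]
    simp
  generalize μ - μ Set.univ • diracSM e = ν at *
  have hap := fun A (hA : MeasurableSet A) =>
    SignedMeasure.apply_eq_posPart_real_sub_negPart_real ν hA
  have hbal := hap _ MeasurableSet.univ
  rw [hν0] at hbal
  by_cases hP : ν.toJordanDecomposition.posPart = 0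
  · have hQ : ν.toJordanDecomposition.negPart = 0 := by
      rw [hP] at hbal
      have h1 : ν.toJordanDecomposition.negPart.real Set.univ = 0 := by
        simpa using hbal.symm
      rwa [measureReal_eq_zero_iff, Measure.measure_univ_eq_zero] at h1
    refine ⟨e, e, 1, one_pos, ?_⟩
    rw [sub_self]
    ext A hA
    rw [hap A hA, hP, hQ]
    simp
  · have hPu : 0 < ν.toJordanDecomposition.posPart.real Set.univ := by
      rw [measureReal_def, ENNReal.toReal_pos_iff]
      exact ⟨pos_iff_ne_zero.2 (by rwa [Ne, Measure.measure_univ_eq_zero]), measure_lt_top _ _⟩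
    have hQ : ν.toJordanDecomposition.negPart ≠ 0 := by
      intro h
      rw [h] at hbal
      have : (0 : Measure Z).real Set.univ = 0 := by simp
      linarith
    obtain ⟨x, hx⟩ := exists_dirac _ hz1 hP
    obtain ⟨y, hy⟩ := exists_dirac _ hz2 hQ
    refine ⟨x, y, _, hPu, ?_⟩
    ext A hA
    rw [hap A hA, hx A hA, hy A hA, _root_.sub_apply, _root_.smul_apply,
      _root_.smul_apply, diracSM_apply _ A hA, diracSM_apply _ A hA, smul_eq_mul, smul_eq_mul]
    have : ν.toJordanDecomposition.negPart.real Set.univ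
      = ν.toJordanDecomposition.posPart.real Set.univ := by linarith
    rw [this]
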